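/- Let n, h, H be as in the grid-interpolation setup. Define Φ2(τ_u,θ_u,τ_v,θ_v) = H(τ_u,θ_u) + H(τ_v,θ_v) + (1−h(τ_u,θ_u))·(1−θ_v), and let Φ̃2(τ_u,θ_u,τ_v,θ_v) be the 4-dimensional multilinear interpolation of Φ2, i.e. the sum over the 16 grid corners (c_u,d_u,c_v,d_v), where c_u ∈ {τ̄_u,τ̂_u}, d_u ∈ {θ̄_u,θ̂_u}, c_v ∈ {τ̄_v,τ̂_v}, d_v ∈ {θ̄_v,θ̂_v}, of Φ2(c_u,d_u,c_v,d_v) weighted by the product of the corresponding interpolation weights (z(x) for the upper grid point x̂ and 1−z(x) for the lower grid point x̄ in each coordinate). Then for all 0 ≤ τ_u ≤ θ_u ≤ 1 and 0 ≤ τ_v ≤ θ_v ≤ 1: Φ2(τ_u,θ_u,τ_v,θ_v) ≥ Φ̃2(τ_u,θ_u,τ_v,θ_v) − 5/n². -/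

import Mathlib

/-- Lower grid point: `x̄ = ⌊nx⌋/n` for `x ∈ [0,1)`, and `1̄ = 1`. -/
noncomputable def gbar (n : ℕ) (x : ℝ) : ℝ :=
  if x = 1 then 1 else (⌊(n : ℝ) * x⌋ : ℝ) / n

/-- Upper grid point: `x̂ = x̄ + 1/n` for `x ∈ [0,1)`, and `1̂ = 1`. -/
noncomputable def ghat (n : ℕ) (x : ℝ) : ℝ :=
  if x = 1 then 1 else (⌊(n : ℝ) * x⌋ : ℝ) / n + 1 / n

/-- Interpolation weight: `z(x) = n·(x − x̄)` for `x ∈ [0,1)`, and `z(1) = 0`. -/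
noncomputable def gz (n : ℕ) (x : ℝ) : ℝ :=
  if x = 1 then 0 else (n : ℝ) * (x - (⌊(n : ℝ) * x⌋ : ℝ) / n)

/-- `H(τ,θ) = θ·h(τ,θ) − ∫_τ^θ h(τ,y) dy` (signed integral). -/
noncomputable def gridH (h : ℝ → ℝ → ℝ) (τ θ : ℝ) : ℝ :=
  θ * h τ θ - ∫ y in τ..θ, h τ y

/-- Bilinear interpolation of a two-variable function at the grid corners. -/
noncomputable def interp2 (n : ℕ) (F : ℝ → ℝ → ℝ) (τ θ : ℝ) : ℝ :=
  (1 - gz n τ) * (1 - gz n θ) * F (gbar n τ) (gbar n θ)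
  + (1 - gz n τ) * gz n θ * F (gbar n τ) (ghat n θ)
  + gz n τ * (1 - gz n θ) * F (ghat n τ) (gbar n θ)
  + gz n τ * gz n θ * F (ghat n τ) (ghat n θ)

/-- 4-dimensional multilinear interpolation of a four-variable function at the 16 grid
corners, with product weights (`z(x)` for the upper grid point `x̂` and `1 − z(x)` for
the lower grid point `x̄` in each coordinate). -/
noncomputable def interp4 (n : ℕ) (F : ℝ → ℝ → ℝ → ℝ → ℝ)
    (τu θu τv θv : ℝ) : ℝ :=
  interp2 n (fun a b => interp2 n (F a b) τv θv) τu θu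

/-- `Φ2(τ_u,θ_u,τ_v,θ_v) = H(τ_u,θ_u) + H(τ_v,θ_v) + (1 − h(τ_u,θ_u))·(1 − θ_v)`. -/
noncomputable def Phi2 (h : ℝ → ℝ → ℝ) (τu θu τv θv : ℝ) : ℝ :=
  gridH h τu θu + gridH h τv θv + (1 - h τu θu) * (1 - θv)

lemma floor_mul_natCast_div {n : ℕ} (hn : 0 < n) (i : ℕ) : ⌊(n : ℝ) * ((i : ℝ) / n)⌋ = i := by
  have hn' : (n : ℝ) ≠ 0 := by positivity
  rw [mul_div_cancel₀ _ hn', Int.floor_natCast]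

lemma gz_natCast_div {n : ℕ} (hn : 0 < n) (i : ℕ) : gz n ((i : ℝ) / n) = 0 := by
  unfold gz
  rw [floor_mul_natCast_div hn]
  simp

lemma gbar_natCast_div {n : ℕ} (hn : 0 < n) (i : ℕ) : gbar n ((i : ℝ) / n) = (i : ℝ) / n := by
  unfold gbar
  rw [floor_mul_natCast_div hn]
  split_ifs with h
  · exact h.symm
  · simp

lemma natCast_div_mem_Icc {n i : ℕ} (hn : 0 < n) (hi : i ≤ n) :
    (i : ℝ) / n ∈ Set.Icc (0 : ℝ) 1 := by
  have hn' : (0 : ℝ) < n := by positivity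
  exact ⟨by positivity, (div_le_one hn').2 (by exact_mod_cast hi)⟩

lemma gz_of_floor_eq {n : ℕ} (hn : 0 < n) {i : ℕ} (hi : i < n) {t : ℝ} (ht0 : 0 ≤ t)
    (ht1 : t < 1) :
    gz n ((i + t) / n) = t ∧ gbar n ((i + t) / n) = i / n ∧
      ghat n ((i + t) / n) = ((i + 1 : ℕ) : ℝ) / n := by
  have hn' : (0 : ℝ) < n := by positivity
  have hlt : ((i : ℝ) + t) / n ≠ 1 := by
    have : (i : ℝ) + 1 ≤ n := by exact_mod_cast hi
    rw [Ne, div_eq_one_iff_eq hn'.ne']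
    intro h
    linarith
  have hfl : ⌊(n : ℝ) * (((i : ℝ) + t) / n)⌋ = i := by
    rw [mul_div_cancel₀ _ hn'.ne', Int.floor_eq_iff]
    constructor
    · simpa using ht0
    · simpa using ht1
  unfold gz gbar ghat
  simp only [hlt, if_false, hfl]
  refine ⟨?_, by simp, ?_⟩
  · push_cast
    field_simp
    ring
  · push_cast
    ring

/-- The cell of a point of `[0,1]`; it is degenerate exactly at `1`. -/
lemma exists_cell {n : ℕ} (hn : 0 < n) {x : ℝ} (hx : x ∈ Set.Icc (0 : ℝ) 1) :
    (x = 1 ∧ gbar n x = (n : ℝ) / n ∧ ghat n x = (n : ℝ) / n ∧ gz n x = 0) ∨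
    ∃ i : ℕ, i < n ∧ gbar n x = (i : ℝ) / n ∧ ghat n x = ((i + 1 : ℕ) : ℝ) / n ∧
      0 ≤ gz n x ∧ gz n x < 1 ∧ x = (i + gz n x) / n := by
  have hn' : (0 : ℝ) < n := by positivity
  rcases eq_or_ne x 1 with rfl | hx1
  · left
    simp [gbar, ghat, gz, hn'.ne']
  · right
    have hnx : 0 ≤ (n : ℝ) * x := mul_nonneg hn'.le hx.1
    have hlt : x < 1 := lt_of_le_of_ne hx.2 hx1
    have hxe : x = ((⌊(n : ℝ) * x⌋₊ : ℝ) + ((n : ℝ) * x - ⌊(n : ℝ) * x⌋₊)) / n := by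
      field_simp
      ring
    have h0 : 0 ≤ (n : ℝ) * x - ⌊(n : ℝ) * x⌋₊ := sub_nonneg.2 (Nat.floor_le hnx)
    have h1 : (n : ℝ) * x - ⌊(n : ℝ) * x⌋₊ < 1 := by
      linarith [Nat.lt_floor_add_one ((n : ℝ) * x)]
    have hi : ⌊(n : ℝ) * x⌋₊ < n := by
      rw [Nat.floor_lt hnx]
      nlinarith
    obtain ⟨hz, hb, hh⟩ := gz_of_floor_eq hn hi h0 h1
    rw [← hxe] at hz hb hh
    refine ⟨_, hi, hb, hh, by rw [hz]; exact h0, by rw [hz]; exact h1, by rw [hz]; exact hxe⟩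

/-- Uniform description of the cell of a point, covering the degenerate one at `1`. -/
lemma exists_grid_indices {n : ℕ} (hn : 0 < n) {x : ℝ} (hx : x ∈ Set.Icc (0 : ℝ) 1) :
    ∃ i j : ℕ, i ≤ j ∧ j ≤ i + 1 ∧ j ≤ n ∧ gbar n x = (i : ℝ) / n ∧ ghat n x = (j : ℝ) / n ∧
      0 ≤ gz n x ∧ gz n x ≤ 1 ∧ x = gbar n x + (ghat n x - gbar n x) * gz n x := by
  have hn' : (0 : ℝ) < n := by positivity
  rcases exists_cell hn hx with ⟨h1, hb, hh, hz⟩ | ⟨i, hi, hb, hh, h0, h1, hxe⟩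
  · refine ⟨n, n, le_rfl, by omega, le_rfl, hb, hh, hz.ge, by simp [hz], ?_⟩
    rw [hz, hb, h1, div_self hn'.ne']
    ring
  · refine ⟨i, i + 1, by omega, le_rfl, hi, hb, hh, h0, h1.le, ?_⟩
    rw [hb, hh]
    refine hxe.trans ?_
    push_cast
    ring

section Interpolated

variable {n : ℕ} {h : ℝ → ℝ → ℝ}

lemma eq_interp_right_at_grid (hn : 0 < n)
    (hinterp : ∀ τ ∈ Set.Icc (0:ℝ) 1, ∀ θ ∈ Set.Icc (0:ℝ) 1, h τ θ = interp2 n h τ θ)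
    {i : ℕ} (hi : i ≤ n) {y : ℝ} (hy : y ∈ Set.Icc (0 : ℝ) 1) :
    h ((i : ℝ) / n) y
      = (1 - gz n y) * h ((i : ℝ) / n) (gbar n y) + gz n y * h ((i : ℝ) / n) (ghat n y) := by
  have e := hinterp _ (natCast_div_mem_Icc hn hi) y hy
  simp only [interp2, gz_natCast_div hn, gbar_natCast_div hn] at e
  linear_combination e

lemma eq_interp_left_at_grid (hn : 0 < n)
    (hinterp : ∀ τ ∈ Set.Icc (0:ℝ) 1, ∀ θ ∈ Set.Icc (0:ℝ) 1, h τ θ = interp2 n h τ θ)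
    {i : ℕ} (hi : i ≤ n) {x : ℝ} (hx : x ∈ Set.Icc (0 : ℝ) 1) :
    h x ((i : ℝ) / n)
      = (1 - gz n x) * h (gbar n x) ((i : ℝ) / n) + gz n x * h (ghat n x) ((i : ℝ) / n) := by
  have e := hinterp x hx _ (natCast_div_mem_Icc hn hi)
  simp only [interp2, gz_natCast_div hn, gbar_natCast_div hn] at e
  linear_combination e

lemma eq_interp_left (hn : 0 < n)
    (hinterp : ∀ τ ∈ Set.Icc (0:ℝ) 1, ∀ θ ∈ Set.Icc (0:ℝ) 1, h τ θ = interp2 n h τ θ)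
    {x y : ℝ} (hx : x ∈ Set.Icc (0 : ℝ) 1) (hy : y ∈ Set.Icc (0 : ℝ) 1) :
    h x y = (1 - gz n x) * h (gbar n x) y + gz n x * h (ghat n x) y := by
  obtain ⟨i, j, hij, -, hjn, hb, hh, -⟩ := exists_grid_indices hn hx
  have e := hinterp x hx y hy
  have e1 := eq_interp_right_at_grid hn hinterp (hij.trans hjn) hy
  have e2 := eq_interp_right_at_grid hn hinterp hjn hy
  rw [← hb] at e1
  rw [← hh] at e2
  rw [e, e1, e2, interp2]
  ring

lemma eq_interp_right (hn : 0 < n)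
    (hinterp : ∀ τ ∈ Set.Icc (0:ℝ) 1, ∀ θ ∈ Set.Icc (0:ℝ) 1, h τ θ = interp2 n h τ θ)
    {x y : ℝ} (hx : x ∈ Set.Icc (0 : ℝ) 1) (hy : y ∈ Set.Icc (0 : ℝ) 1) :
    h x y = (1 - gz n y) * h x (gbar n y) + gz n y * h x (ghat n y) := by
  obtain ⟨i, j, hij, -, hjn, hb, hh, -⟩ := exists_grid_indices hn hy
  have e := hinterp x hx y hy
  have e1 := eq_interp_left_at_grid hn hinterp (hij.trans hjn) hx
  have e2 := eq_interp_left_at_grid hn hinterp hjn hx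
  rw [← hb] at e1
  rw [← hh] at e2
  rw [e, e1, e2, interp2]
  ring

/-- `h x` is affine on each grid cell. -/
lemma affine_on_cell (hn : 0 < n)
    (hinterp : ∀ τ ∈ Set.Icc (0:ℝ) 1, ∀ θ ∈ Set.Icc (0:ℝ) 1, h τ θ = interp2 n h τ θ)
    {x y t : ℝ} (hx : x ∈ Set.Icc (0 : ℝ) 1) (hy : y ∈ Set.Icc (0 : ℝ) 1)
    (ht : t ∈ Set.Icc (0 : ℝ) 1) :
    h x (gbar n y + (ghat n y - gbar n y) * t)
      = (1 - t) * h x (gbar n y) + t * h x (ghat n y) := by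
  have hn' : (0 : ℝ) < n := by positivity
  rcases eq_or_lt_of_le ht.2 with rfl | ht1
  · simp
  rcases exists_cell hn hy with ⟨-, hb, hh, -⟩ | ⟨i, hi, hb, hh, -⟩
  · rw [hb, hh]
    simp only [sub_self, zero_mul, add_zero]
    ring
  · obtain ⟨hz, hb', hh'⟩ := gz_of_floor_eq hn hi ht.1 ht1
    have hi' : (i : ℝ) + 1 ≤ n := by exact_mod_cast hi
    have hmem : ((i : ℝ) + t) / n ∈ Set.Icc (0 : ℝ) 1 :=
      ⟨div_nonneg (by linarith [ht.1, i.cast_nonneg (α := ℝ)]) hn'.le,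
        (div_le_one hn').2 (by linarith)⟩
    have e := eq_interp_right hn hinterp hx hmem
    rw [hz, hb', hh'] at e
    have harg : (i : ℝ) / n + (((i + 1 : ℕ) : ℝ) / n - (i : ℝ) / n) * t = (i + t) / n := by
      push_cast
      ring
    rw [hb, hh, harg, e]

end Interpolated

/-- The integral of a function that is affine on a segment, up to an intermediate point. -/
lemma integral_of_affine {f : ℝ → ℝ} {b b' t : ℝ} (ht0 : 0 ≤ t)
    (hf : ∀ u ∈ Set.Icc 0 t, f (b + (b' - b) * u) = (1 - u) * f b + u * f b') :
    ∫ y in b..(b + (b' - b) * t), f y = (b' - b) * (t * f b + t ^ 2 / 2 * (f b' - f b)) := by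
  have hsub := intervalIntegral.mul_integral_comp_add_mul (a := 0) (b := t) (f := f) (b' - b) b
  rw [mul_zero, add_zero] at hsub
  rw [← hsub]
  congr 1
  have hcongr : ∫ u in (0 : ℝ)..t, f (b + (b' - b) * u)
      = ∫ u in (0 : ℝ)..t, (f b + u * (f b' - f b)) := by
    refine intervalIntegral.integral_congr fun u hu => ?_
    rw [Set.uIcc_of_le ht0] at hu
    simp only [hf u hu]
    ring
  rw [hcongr, intervalIntegral.integral_add (by simp)
    (Continuous.intervalIntegrable (by fun_prop) _ _),
    intervalIntegral.integral_mul_const, integral_id]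
  simp

/-- Interpolation error of `θ ↦ θ f(θ) - ∫₀^θ f` on a segment where `f` is affine. -/
lemma interp_error_of_affine {f : ℝ → ℝ} {b b' t : ℝ} (ht : t ∈ Set.Icc (0 : ℝ) 1)
    (hf : ∀ u ∈ Set.Icc (0 : ℝ) 1, f (b + (b' - b) * u) = (1 - u) * f b + u * f b')
    (hint : IntervalIntegrable f MeasureTheory.volume 0 b)
    (hint' : IntervalIntegrable f MeasureTheory.volume 0 b')
    (hintt : IntervalIntegrable f MeasureTheory.volume 0 (b + (b' - b) * t)) :
    (1 - t) * (b * f b - ∫ y in (0 : ℝ)..b, f y) + t * (b' * f b' - ∫ y in (0 : ℝ)..b', f y)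
      - ((b + (b' - b) * t) * f (b + (b' - b) * t) - ∫ y in (0 : ℝ)..(b + (b' - b) * t), f y)
      = t * (1 - t) / 2 * ((b' - b) * (f b' - f b)) := by
  have e1 := integral_of_affine zero_le_one hf
  rw [mul_one, add_sub_cancel] at e1
  have e2 := integral_of_affine ht.1 fun u hu => hf u ⟨hu.1, hu.2.trans ht.2⟩
  have a1 := intervalIntegral.integral_add_adjacent_intervals hint (hint.symm.trans hint')
  have a2 := intervalIntegral.integral_add_adjacent_intervals hint (hint.symm.trans hintt)
  rw [← a1, ← a2, e1, e2, hf t ht]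
  ring

/-- A monotone function's integral between two points is at most length times right value. -/
lemma integral_le_of_monotoneOn {f : ℝ → ℝ} {a b : ℝ} (hab : a ≤ b)
    (hf : MonotoneOn f (Set.Icc a b)) : ∫ y in a..b, f y ≤ (b - a) * f b := by
  have hint : IntervalIntegrable f MeasureTheory.volume a b :=
    (Set.uIcc_of_le hab ▸ hf : MonotoneOn f (Set.uIcc a b)).intervalIntegrable
  have := intervalIntegral.integral_mono_on hab hint
    (intervalIntegrable_const (c := f b)) fun y hy => hf hy ⟨hab, le_rfl⟩ hy.2
  simpa using this

/-- A monotone function's integral between two points is at least length times left value. -/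
lemma le_integral_of_monotoneOn {f : ℝ → ℝ} {a b : ℝ} (hab : a ≤ b)
    (hf : MonotoneOn f (Set.Icc a b)) : (b - a) * f a ≤ ∫ y in a..b, f y := by
  have hint : IntervalIntegrable f MeasureTheory.volume a b :=
    (Set.uIcc_of_le hab ▸ hf : MonotoneOn f (Set.uIcc a b)).intervalIntegrable
  have := intervalIntegral.integral_mono_on hab
    (intervalIntegrable_const (c := f a)) hint fun y hy => hf ⟨le_rfl, hab⟩ hy hy.1
  simpa using this

lemma mul_one_sub_le_quarter (t : ℝ) : t * (1 - t) ≤ 1 / 4 := by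
  nlinarith [sq_nonneg (t - 1 / 2)]

/-- One-step increments of a function on the grid bound its increment across any cell. -/
lemma increment_le_of_step {n : ℕ} {g : ℝ → ℝ} {i j : ℕ} (hij : i ≤ j) (hji : j ≤ i + 1)
    (hjn : j ≤ n)
    (hg : ∀ k : ℕ, k + 1 ≤ n → g (((k : ℝ) + 1) / n) ≤ g ((k : ℝ) / n) + 4 / n) :
    g ((j : ℝ) / n) ≤ g ((i : ℝ) / n) + 4 / n := by
  obtain rfl | rfl : j = i ∨ j = i + 1 := by omega
  · have : (0 : ℝ) ≤ 4 / n := by positivity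
    linarith
  · simpa using hg i hjn

lemma interp2_gridH_le {n : ℕ} (hn : 0 < n) {h : ℝ → ℝ → ℝ}
    (hinterp : ∀ τ ∈ Set.Icc (0:ℝ) 1, ∀ θ ∈ Set.Icc (0:ℝ) 1, h τ θ = interp2 n h τ θ)
    (hmono_right : ∀ τ ∈ Set.Icc (0:ℝ) 1, MonotoneOn (fun θ => h τ θ) (Set.Icc 0 1))
    (hlip_right : ∀ i j : ℕ, i ≤ n → j + 1 ≤ n →
      h ((i:ℝ)/n) (((j:ℝ)+1)/n) ≤ h ((i:ℝ)/n) ((j:ℝ)/n) + 4 / n)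
    (hlip_left : ∀ i j : ℕ, i + 1 ≤ n → j ≤ n →
      h (((i:ℝ)+1)/n) ((j:ℝ)/n) ≤ h ((i:ℝ)/n) ((j:ℝ)/n) + 4 / n)
    {τ θ : ℝ} (hτ : τ ∈ Set.Icc (0 : ℝ) 1) (hθ : θ ∈ Set.Icc (0 : ℝ) 1) :
    interp2 n (gridH h) τ θ ≤ gridH h τ θ + 5 / 2 / (n : ℝ) ^ 2 := by
  have hn' : (0 : ℝ) < n := by positivity
  obtain ⟨i, i', hii, hii1, hin, ha, ha', hs0, hs1, hτe⟩ := exists_grid_indices hn hτ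
  obtain ⟨j, j', hjj, hjj1, hjn, hb, hb', ht0, ht1, hθe⟩ := exists_grid_indices hn hθ
  have hma := natCast_div_mem_Icc hn (hii.trans hin)
  have hma' := natCast_div_mem_Icc hn hin
  have hmb := natCast_div_mem_Icc hn (hjj.trans hjn)
  have hmb' := natCast_div_mem_Icc hn hjn
  have hwidth : ∀ {k k' : ℕ}, k ≤ k' → k' ≤ k + 1 →
      0 ≤ (k' : ℝ) / n - k / n ∧ (k' : ℝ) / n - k / n ≤ 1 / n := by
    intro k k' h1 h2
    have h1' : (k : ℝ) ≤ k' := by exact_mod_cast h1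
    have h2' : (k' : ℝ) ≤ k + 1 := by exact_mod_cast h2
    rw [← sub_div]
    exact ⟨div_nonneg (by linarith) hn'.le, by gcongr; linarith⟩
  have hwa := hwidth hii hii1
  have hwb := hwidth hjj hjj1
  have haff : ∀ x ∈ Set.Icc (0 : ℝ) 1, ∀ t ∈ Set.Icc (0 : ℝ) 1, _ :=
    fun x hx t ht => affine_on_cell hn hinterp hx hθ ht
  have hstep_b : ∀ k : ℕ, k ≤ n →
      h ((k : ℝ) / n) ((j' : ℝ) / n) ≤ h ((k : ℝ) / n) ((j : ℝ) / n) + 4 / n :=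
    fun k hk => increment_le_of_step hjj hjj1 hjn fun l hl => hlip_right k l hk hl
  have hstep_diag : h ((i' : ℝ) / n) ((i' : ℝ) / n) ≤ h ((i : ℝ) / n) ((i : ℝ) / n) + 8 / n := by
    have h1 : h ((i' : ℝ) / n) ((i' : ℝ) / n) ≤ h ((i' : ℝ) / n) ((i : ℝ) / n) + 4 / n :=
      increment_le_of_step hii hii1 hin fun l hl => hlip_right i' l hin hl
    have h2 : h ((i' : ℝ) / n) ((i : ℝ) / n) ≤ h ((i : ℝ) / n) ((i : ℝ) / n) + 4 / n :=
      increment_le_of_step (g := fun x => h x ((i : ℝ) / n)) hii hii1 hin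
        fun l hl => hlip_left l i hl (hii.trans hin)
    have h3 : (8 : ℝ) / n = 4 / n + 4 / n := by ring
    linarith
  have hleft : ∀ y ∈ Set.Icc (0 : ℝ) 1,
      h τ y = (1 - gz n τ) * h (gbar n τ) y + gz n τ * h (ghat n τ) y :=
    fun y hy => eq_interp_left hn hinterp hτ hy
  unfold interp2
  rw [ha, ha'] at hτe hleft ⊢
  rw [hb, hb'] at hθe haff ⊢
  generalize gz n τ = s at *
  generalize gz n θ = t at *
  set a : ℝ := (i : ℝ) / n
  set a' : ℝ := (i' : ℝ) / n
  set b : ℝ := (j : ℝ) / n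
  set b' : ℝ := (j' : ℝ) / n
  have hint : ∀ x ∈ Set.Icc (0 : ℝ) 1, ∀ c ∈ Set.Icc (0 : ℝ) 1, ∀ d ∈ Set.Icc (0 : ℝ) 1,
      IntervalIntegrable (h x) MeasureTheory.volume c d := fun x hx c hc d hd =>
    ((hmono_right x hx).mono (Set.uIcc_subset_Icc hc hd)).intervalIntegrable
  have h0 : (0 : ℝ) ∈ Set.Icc (0 : ℝ) 1 := by simp
  have hH : ∀ x ∈ Set.Icc (0 : ℝ) 1, ∀ c ∈ Set.Icc (0 : ℝ) 1, ∀ y ∈ Set.Icc (0 : ℝ) 1,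
      ∫ z in c..y, h x z = (∫ z in (0 : ℝ)..y, h x z) - ∫ z in (0 : ℝ)..c, h x z :=
    fun x hx c hc y hy => (intervalIntegral.integral_interval_sub_left
      (hint x hx _ h0 _ hy) (hint x hx _ h0 _ hc)).symm
  have hsplit : ∫ y in τ..θ, h τ y
      = (1 - s) * (∫ y in τ..θ, h a y) + s * ∫ y in τ..θ, h a' y := by
    rw [← intervalIntegral.integral_const_mul, ← intervalIntegral.integral_const_mul,
      ← intervalIntegral.integral_add ((hint a hma _ hτ _ hθ).const_mul _)
        ((hint a' hma' _ hτ _ hθ).const_mul _)]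
    exact intervalIntegral.integral_congr fun y hy => hleft y (Set.uIcc_subset_Icc hτ hθ hy)
  have herr : ∀ k : ℕ, k ≤ n →
      (1 - t) * (b * h (k / n) b - ∫ y in (0 : ℝ)..b, h (k / n) y)
        + t * (b' * h (k / n) b' - ∫ y in (0 : ℝ)..b', h (k / n) y)
        - (θ * h (k / n) θ - ∫ y in (0 : ℝ)..θ, h (k / n) y) ≤ 1 / 2 / (n : ℝ) ^ 2 := by
    intro k hk
    have hx := natCast_div_mem_Icc hn hk
    have e := interp_error_of_affine (f := h (k / n)) ⟨ht0, ht1⟩ (haff _ hx)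
      (hint _ hx _ h0 _ hmb) (hint _ hx _ h0 _ hmb') (hint _ hx _ h0 _ (hθe ▸ hθ))
    rw [← hθe] at e
    rw [e]
    have hinc : h (k / n) b' - h (k / n) b ≤ 4 / n := by linarith [hstep_b k hk]
    have hinc0 : 0 ≤ h (k / n) b' - h (k / n) b :=
      sub_nonneg.2 (hmono_right _ hx hmb hmb' (by linarith [hwb.1]))
    calc t * (1 - t) / 2 * ((b' - b) * (h (k / n) b' - h (k / n) b))
        ≤ 1 / 4 / 2 * (1 / n * (4 / n)) := by
          have := mul_one_sub_le_quarter t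
          have := mul_nonneg hwb.1 hinc0
          gcongr
          exact hwb.2
      _ = 1 / 2 / (n : ℝ) ^ 2 := by
          field_simp
  have haτ : a ≤ τ := by nlinarith [mul_nonneg hwa.1 hs0]
  have hτa' : τ ≤ a' := by nlinarith [mul_nonneg hwa.1 (sub_nonneg.2 hs1)]
  have hlow := le_integral_of_monotoneOn haτ
    ((hmono_right a hma).mono (Set.Icc_subset_Icc hma.1 hτ.2))
  have hupp := integral_le_of_monotoneOn hτa'
    ((hmono_right a' hma').mono (Set.Icc_subset_Icc hτ.1 hma'.2))
  have hdiag : s * (∫ y in τ..a', h a' y) - (1 - s) * ∫ y in a..τ, h a y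
      ≤ 2 / (n : ℝ) ^ 2 := by
    have hs1' : 0 ≤ 1 - s := sub_nonneg.2 hs1
    have hq : 0 ≤ s * (1 - s) := mul_nonneg hs0 hs1'
    calc s * (∫ y in τ..a', h a' y) - (1 - s) * ∫ y in a..τ, h a y
        ≤ s * ((a' - τ) * h a' a') - (1 - s) * ((τ - a) * h a a) := by gcongr
      _ = s * (1 - s) * ((a' - a) * (h a' a' - h a a)) := by
          rw [show τ = a + (a' - a) * s from hτe]
          ring
      _ ≤ s * (1 - s) * ((a' - a) * (8 / n)) := by
          have := hwa.1
          gcongr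
          linarith
      _ ≤ 1 / 4 * (1 / n * (8 / n)) := by
          have := mul_one_sub_le_quarter s
          have := hwa.1
          have := hwa.2
          gcongr
      _ = 2 / (n : ℝ) ^ 2 := by
          field_simp
          norm_num
  have hE := add_le_add (mul_le_mul_of_nonneg_left (herr i (hii.trans hin)) (sub_nonneg.2 hs1))
    (mul_le_mul_of_nonneg_left (herr i' hin) hs0)
  have hconst : (5 : ℝ) / 2 / n ^ 2 = 1 / 2 / n ^ 2 + 2 / n ^ 2 := by ring
  simp only [gridH]
  rw [hsplit, hleft θ hθ, hconst]
  rw [hH a' hma' τ hτ a' hma', hH a hma a hma τ hτ] at hdiag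
  rw [hH a hma a hma b hmb, hH a hma a hma b' hmb', hH a' hma' a' hma' b hmb,
    hH a' hma' a' hma' b' hmb', hH a hma τ hτ θ hθ, hH a' hma' τ hτ θ hθ]
  linarith

lemma gbar_add_gz {n : ℕ} (hn : 0 < n) {x : ℝ} (hx : x ∈ Set.Icc (0 : ℝ) 1) :
    (1 - gz n x) * gbar n x + gz n x * ghat n x = x := by
  obtain ⟨-, -, -, -, -, -, -, -, -, hxe⟩ := exists_grid_indices hn hx
  linear_combination -hxe

/-- The interpolation of `Φ2` splits, since `(1 - h) (1 - θ)` is reproduced exactly. -/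
lemma interp4_Phi2 {n : ℕ} (hn : 0 < n) {h : ℝ → ℝ → ℝ}
    (hinterp : ∀ τ ∈ Set.Icc (0:ℝ) 1, ∀ θ ∈ Set.Icc (0:ℝ) 1, h τ θ = interp2 n h τ θ)
    {τu θu : ℝ} (hτu : τu ∈ Set.Icc (0 : ℝ) 1) (hθu : θu ∈ Set.Icc (0 : ℝ) 1)
    (τv : ℝ) {θv : ℝ} (hθv : θv ∈ Set.Icc (0 : ℝ) 1) :
    interp4 n (Phi2 h) τu θu τv θv
      = interp2 n (gridH h) τu θu + interp2 n (gridH h) τv θv + (1 - h τu θu) * (1 - θv) := by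
  have hinner : ∀ x y, interp2 n (Phi2 h x y) τv θv
      = gridH h x y + interp2 n (gridH h) τv θv + (1 - h x y) * (1 - θv) := by
    intro x y
    simp only [interp2, Phi2]
    linear_combination (h x y - 1) * gbar_add_gz hn hθv
  have e := hinterp τu hτu θu hθu
  simp only [interp4, hinner]
  generalize interp2 n (gridH h) τv θv = C
  simp only [interp2] at e ⊢
  linear_combination (1 - θv) * e

/-- **Interpolation bound for `Φ2`.**
For `h` equal to the bilinear interpolation of its grid values, nondecreasing in each
coordinate and step-Lipschitz at grid points, and `Φ̃2` the 4-dimensional multilinear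
interpolation of `Φ2` at the 16 grid corners, for all `0 ≤ τ_u ≤ θ_u ≤ 1` and
`0 ≤ τ_v ≤ θ_v ≤ 1`: `Φ2 ≥ Φ̃2 − 5/n²`. -/
theorem Phi2_interp_bound
    (n : ℕ) (hn : 0 < n) (h : ℝ → ℝ → ℝ)
    (hinterp : ∀ τ ∈ Set.Icc (0:ℝ) 1, ∀ θ ∈ Set.Icc (0:ℝ) 1,
      h τ θ = (1 - gz n τ) * (1 - gz n θ) * h (gbar n τ) (gbar n θ)
        + (1 - gz n τ) * gz n θ * h (gbar n τ) (ghat n θ)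
        + gz n τ * (1 - gz n θ) * h (ghat n τ) (gbar n θ)
        + gz n τ * gz n θ * h (ghat n τ) (ghat n θ))
    (hmono_left : ∀ θ ∈ Set.Icc (0:ℝ) 1, MonotoneOn (fun τ => h τ θ) (Set.Icc 0 1))
    (hmono_right : ∀ τ ∈ Set.Icc (0:ℝ) 1, MonotoneOn (fun θ => h τ θ) (Set.Icc 0 1))
    (hlip_right : ∀ i j : ℕ, i ≤ n → j + 1 ≤ n →
      h ((i:ℝ)/n) (((j:ℝ)+1)/n) ≤ h ((i:ℝ)/n) ((j:ℝ)/n) + 4 / n)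
    (hlip_left : ∀ i j : ℕ, i + 1 ≤ n → j ≤ n →
      h (((i:ℝ)+1)/n) ((j:ℝ)/n) ≤ h ((i:ℝ)/n) ((j:ℝ)/n) + 4 / n)
    (τu θu τv θv : ℝ)
    (hτu0 : 0 ≤ τu) (hu : τu ≤ θu) (hθu1 : θu ≤ 1)
    (hτv0 : 0 ≤ τv) (hv : τv ≤ θv) (hθv1 : θv ≤ 1) :
    interp4 n (Phi2 h) τu θu τv θv - 5 / (n:ℝ)^2 ≤ Phi2 h τu θu τv θv := by
  have hτu : τu ∈ Set.Icc (0 : ℝ) 1 := ⟨hτu0, hu.trans hθu1⟩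
  have hθu : θu ∈ Set.Icc (0 : ℝ) 1 := ⟨hτu0.trans hu, hθu1⟩
  have hτv : τv ∈ Set.Icc (0 : ℝ) 1 := ⟨hτv0, hv.trans hθv1⟩
  have hθv : θv ∈ Set.Icc (0 : ℝ) 1 := ⟨hτv0.trans hv, hθv1⟩
  have eu := interp2_gridH_le hn hinterp hmono_right hlip_right hlip_left hτu hθu
  have ev := interp2_gridH_le hn hinterp hmono_right hlip_right hlip_left hτv hθv
  have hconst : (5 : ℝ) / n ^ 2 = 5 / 2 / n ^ 2 + 5 / 2 / n ^ 2 := by ring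
  rw [interp4_Phi2 hn hinterp hτu hθu τv hθv, Phi2, hconst]
  linarith
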